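/- arXiv:2505.18901 — 2 statements merged into one kernel-verified Lean document; each statement's English description precedes it below -/
import Mathlib

section
/- Let $A$ be a finite nonempty set, let $q : A \to \mathbb{R}$ satisfy $0 < q_a \le 1$ for all $a$, let $c : A \to \mathbb{R}$ satisfy $c_a \ge 0$ for all $a$, and let $\lambda \ge 0$. Define $V := \max\big(0, \max_{a \in A} \frac{q_a - \lambda c_a}{q_a}\big)$. Then $V$ satisfies the Bellman fixed-point equation $V = \max\big(0, \max_{a \in A} \{\, q_a - \lambda c_a + (1 - q_a) V \,\}\big)$. -/
/-- The optimal value `V` satisfies the Bellman fixed-point equation. -/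
theorem bellman_fixed_point {A : Type*} [Fintype A] [Nonempty A]
    (q c : A → ℝ) (hq0 : ∀ a, 0 < q a) (hq1 : ∀ a, q a ≤ 1)
    (hc : ∀ a, 0 ≤ c a) (lam : ℝ) (hlam : 0 ≤ lam) :
    let V := max 0 (Finset.univ.sup' Finset.univ_nonempty
      (fun a => (q a - lam * c a) / q a));
    V = max 0 (Finset.univ.sup' Finset.univ_nonempty
      (fun a => q a - lam * c a + (1 - q a) * V)) := by
  intro V
  have ratio_le (a : A) : (q a - lam * c a) / q a ≤ V :=
    le_max_of_le_right (Finset.le_sup' (fun a => (q a - lam * c a) / q a) (Finset.mem_univ a))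
  have net_eq (a : A) : q a * ((q a - lam * c a) / q a) = q a - lam * c a :=
    mul_div_cancel₀ _ (hq0 a).ne'
  apply le_antisymm
  · refine max_le (le_max_left _ _) (Finset.sup'_le _ _ fun a _ => le_max_of_le_right ?_)
    refine le_trans ?_ (Finset.le_sup' (fun a => q a - lam * c a + (1 - q a) * V)
      (Finset.mem_univ a))
    have := mul_le_mul_of_nonneg_left (ratio_le a) (sub_nonneg.2 (hq1 a))
    linarith [net_eq a]
  · refine max_le (le_max_left _ _) (Finset.sup'_le _ _ fun a _ => ?_)
    have := mul_le_mul_of_nonneg_left (ratio_le a) (hq0 a).le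
    linarith [net_eq a]
end

section
/- Let $A$ be a finite nonempty set, let $q : A \to \mathbb{R}$ satisfy $0 < q_a \le 1$ for all $a$, let $c : A \to \mathbb{R}$ satisfy $c_a \ge 0$ for all $a$, and let $\lambda > 0$. Suppose $\max_{a \in A} (q_a - \lambda c_a) > 0$ and set $V := \max_{a \in A} \frac{q_a - \lambda c_a}{q_a}$. If $a^\star \in A$ minimizes $a \mapsto \frac{c_a}{q_a}$ over $A$, then $a^\star$ maximizes $a \mapsto q_a - \lambda c_a + (1 - q_a)\,V$ over $A$, and the maximal value equals $V$. -/
/-- The oracle arm: minimizing `c a / q a` maximizes the Bellman right-hand side,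
with maximal value `V`. -/
theorem oracle_arm_optimal {A : Type*} [Fintype A] [Nonempty A]
    (q c : A → ℝ) (hq0 : ∀ a, 0 < q a) (hq1 : ∀ a, q a ≤ 1)
    (hc : ∀ a, 0 ≤ c a) (lam : ℝ) (hlam : 0 < lam)
    (hpos : 0 < Finset.univ.sup' Finset.univ_nonempty (fun a => q a - lam * c a))
    (astar : A) (hstar : ∀ a, c astar / q astar ≤ c a / q a) :
    let V := Finset.univ.sup' Finset.univ_nonempty
      (fun a => (q a - lam * c a) / q a);
    (∀ a, q a - lam * c a + (1 - q a) * V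
        ≤ q astar - lam * c astar + (1 - q astar) * V) ∧
      q astar - lam * c astar + (1 - q astar) * V = V := by
  intro V
  have ratio_eq (a : A) : (q a - lam * c a) / q a = 1 - lam * (c a / q a) := by
    rw [sub_div, div_self (hq0 a).ne', mul_div_assoc]
  have hV : V = (q astar - lam * c astar) / q astar := by
    refine le_antisymm (Finset.sup'_le _ _ fun a _ => ?_)
      (Finset.le_sup' (fun a => (q a - lam * c a) / q a) (Finset.mem_univ astar))
    rw [ratio_eq, ratio_eq]
    exact sub_le_sub_left (mul_le_mul_of_nonneg_left (hstar a) hlam.le) 1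
  have bellman_le (a : A) : q a - lam * c a + (1 - q a) * V ≤ V := by
    have h : (q a - lam * c a) / q a ≤ V :=
      Finset.le_sup' (fun a => (q a - lam * c a) / q a) (Finset.mem_univ a)
    rw [div_le_iff₀ (hq0 a)] at h
    linarith
  have bellman_eq : q astar - lam * c astar + (1 - q astar) * V = V := by
    rw [eq_div_iff (hq0 astar).ne'] at hV
    linarith
  exact ⟨fun a => (bellman_le a).trans_eq bellman_eq.symm, bellman_eq⟩
end
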